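/- (Lemma 4.1) For α ∈ [−1,1], define Υ_α : L^λ(μ) × L^λ(μ) → L¹(μ) by Υ_α(ã, b̃)(x) = ξ_α(ã(x)) ξ_{−α}(b̃(x)). For any integers 0 ≤ i, j ≤ ⌊λ⌋−1 with i + j ≤ ⌈λ⌉−1, the map Υ_α is of class C^{i,j} (it admits continuous partial Fréchet derivatives of order i in the first variable and order j in the second variable), and the partial derivative D₁^iD₂^jΥ_{α,ã,b̃} is the continuous (i+j)-linear map (ũ₁,…,ũ_i; ṽ₁,…,ṽ_j) ↦ ξ_α^{(i)}(ã) ξ_{−α}^{(j)}(b̃) ũ₁⋯ũ_i ṽ₁⋯ṽ_j (pointwise product, valued in L¹(μ)). -/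

import Mathlib

open MeasureTheory Real Set

section Abstract

open Filter Topology

variable {E G : Type*} {Z : ℕ → Type*} [NormedAddCommGroup E] [NormedSpace ℝ E]
  [NormedAddCommGroup G] [NormedSpace ℝ G]
  [∀ n, NormedAddCommGroup (Z n)] [∀ n, NormedSpace ℝ (Z n)]

/-- Iterating bilinear maps `Z (n + 1) × E → Z n` and applying `T : Z 0 → G` at the end turns an
element of `Z n` into an `n`-linear map from `E` to `G`. -/
noncomputable def iteratedBilin (B : ∀ n, Z (n + 1) →L[ℝ] E →L[ℝ] Z n) (T : Z 0 →L[ℝ] G) :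
    ∀ n, Z n →L[ℝ] ContinuousMultilinearMap ℝ (fun _ : Fin n => E) G
  | 0 => ((continuousMultilinearCurryFin0 ℝ E G).symm : G →L[ℝ] _) ∘L T
  | n + 1 => ((continuousMultilinearCurryLeftEquiv ℝ (fun _ : Fin (n + 1) => E) G).symm :
      (E →L[ℝ] ContinuousMultilinearMap ℝ (fun _ : Fin n => E) G) →L[ℝ] _) ∘L
        (ContinuousLinearMap.compL ℝ E (Z n) _ (iteratedBilin B T n)) ∘L B n

theorem iteratedBilin_succ_apply (B : ∀ n, Z (n + 1) →L[ℝ] E →L[ℝ] Z n) (T : Z 0 →L[ℝ] G)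
    (n : ℕ) (c : Z (n + 1)) (u : Fin (n + 1) → E) :
    iteratedBilin B T (n + 1) c u = iteratedBilin B T n (B n c (u 0)) (Fin.tail u) := rfl

theorem iteratedBilin_succ_curryLeft (B : ∀ n, Z (n + 1) →L[ℝ] E →L[ℝ] Z n) (T : Z 0 →L[ℝ] G)
    (n : ℕ) (c : Z (n + 1)) :
    (iteratedBilin B T (n + 1) c).curryLeft = (iteratedBilin B T n) ∘L (B n c) := by
  ext x u
  rw [ContinuousMultilinearMap.curryLeft_apply, iteratedBilin_succ_apply]
  simp

theorem hasFTaylorSeriesUpTo_iteratedBilin (B : ∀ n, Z (n + 1) →L[ℝ] E →L[ℝ] Z n)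
    (T : Z 0 →L[ℝ] G) {N : ℕ} (c : ∀ n, E → Z n)
    (hd : ∀ n < N, ∀ a, HasFDerivAt (c n) (B n (c (n + 1) a)) a) (hc : Continuous (c N)) :
    HasFTaylorSeriesUpTo N (fun a => T (c 0 a)) (fun a n => iteratedBilin B T n (c n a)) where
  zero_eq a := rfl
  fderiv m hm a := by
    have hm' : m < N := by exact_mod_cast hm
    change HasFDerivAt _ (iteratedBilin B T (m + 1) (c (m + 1) a)).curryLeft a
    rw [iteratedBilin_succ_curryLeft]
    exact (iteratedBilin B T m).hasFDerivAt.comp a (hd m hm' a)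
  cont m hm := by
    have hm' : m ≤ N := by exact_mod_cast hm
    refine (iteratedBilin B T m).continuous.comp ?_
    rcases hm'.lt_or_eq with h | rfl
    · exact continuous_iff_continuousAt.2 fun a => (hd m h a).continuousAt
    · exact hc

end Abstract

section Nemytskii

open Filter Topology
open scoped ENNReal

variable {X : Type*} [MeasurableSpace X] {μ : Measure X}

open Classical in
/-- The class of `f` in `L^p` if `f` is in `L^p`, and `0` otherwise. -/
noncomputable def lpMk (p : ℝ≥0∞) (μ : Measure X) (f : X → ℝ) : Lp ℝ p μ :=
  if h : MemLp f p μ then h.toLp f else 0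

theorem coeFn_lpMk {p : ℝ≥0∞} {f : X → ℝ} (h : MemLp f p μ) : lpMk p μ f =ᵐ[μ] f := by
  rw [lpMk, dif_pos h]
  exact h.coeFn_toLp

theorem enorm_lpMk {p : ℝ≥0∞} {f : X → ℝ} (h : MemLp f p μ) :
    ‖lpMk p μ f‖ₑ = eLpNorm f p μ := by
  rw [lpMk, dif_pos h, Lp.enorm_toLp]

theorem exists_subseq_tendsto_ae_of_tendsto_Lp {p : ℝ≥0∞} [Fact (1 ≤ p)] {e : ℕ → Lp ℝ p μ}
    {a : Lp ℝ p μ} (h : Tendsto e atTop (𝓝 a)) :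
    ∃ φ : ℕ → ℕ, StrictMono φ ∧ ∀ᵐ x ∂μ, Tendsto (fun n => e (φ n) x) atTop (𝓝 (a x)) :=
  (tendstoInMeasure_of_tendsto_Lp h).exists_seq_tendsto_ae

theorem tendsto_eLpNorm_of_dominated {q : ℝ≥0∞} (hq : q ≠ ∞) {f : ℕ → X → ℝ} {w : X → ℝ}
    (hf : ∀ n, AEStronglyMeasurable (f n) μ) (hw : MemLp w q μ)
    (hfw : ∀ n x, |f n x| ≤ |w x|) (hlim : ∀ᵐ x ∂μ, Tendsto (fun n => f n x) atTop (𝓝 0)) :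
    Tendsto (fun n => eLpNorm (f n) q μ) atTop (𝓝 0) := by
  rcases eq_or_ne q 0 with rfl | hq0
  · simp
  have hpos : 0 < q.toReal := ENNReal.toReal_pos hq0 hq
  simp only [eLpNorm_eq_lintegral_rpow_enorm_toReal hq0 hq]
  have key : Tendsto (fun n => ∫⁻ x, ‖f n x‖ₑ ^ q.toReal ∂μ) atTop (𝓝 (∫⁻ _, 0 ∂μ)) := by
    refine tendsto_lintegral_of_dominated_convergence' (fun x => ‖w x‖ₑ ^ q.toReal)
      (fun n => (hf n).enorm.pow_const _) (fun n => .of_forall fun x => ?_)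
      (lintegral_rpow_enorm_lt_top_of_eLpNorm_lt_top hq0 hq hw.2).ne ?_
    · refine ENNReal.rpow_le_rpow ?_ hpos.le
      simpa [enorm_le_iff_norm_le] using hfw n x
    · filter_upwards [hlim] with x hx
      have h1 : Tendsto (fun n => ‖f n x‖ₑ) atTop (𝓝 0) := by simpa using hx.enorm
      simpa [hpos, hpos.ne'] using h1.ennrpow_const q.toReal
  simpa [hpos] using key.ennrpow_const (1 / q.toReal)

theorem tendsto_eLpNorm_bounded_mul {p q : ℝ≥0∞} [Fact (1 ≤ p)] (hq : q ≠ ∞)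
    {w : X → ℝ} (hw : MemLp w q μ) {Φ : X → ℝ × ℝ → ℝ} {C : ℝ} (hC : ∀ x s, |Φ x s| ≤ C)
    {a₀ b₀ : Lp ℝ p μ} (hlim : ∀ᵐ x ∂μ, Tendsto (Φ x) (𝓝 (a₀ x, b₀ x)) (𝓝 0))
    (hm : ∀ a b : Lp ℝ p μ, AEStronglyMeasurable (fun x => Φ x (a x, b x)) μ) :
    Tendsto (fun e : Lp ℝ p μ × Lp ℝ p μ => eLpNorm (fun x => Φ x (e.1 x, e.2 x) * w x) q μ)
      (𝓝 (a₀, b₀)) (𝓝 0) := by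
  refine tendsto_of_seq_tendsto fun e he => tendsto_of_subseq_tendsto fun ns hns => ?_
  have he' := he.comp hns
  rw [Prod.tendsto_iff] at he'
  obtain ⟨φ₁, h₁, ha⟩ := exists_subseq_tendsto_ae_of_tendsto_Lp he'.1
  obtain ⟨φ₂, h₂, hb⟩ := exists_subseq_tendsto_ae_of_tendsto_Lp (he'.2.comp h₁.tendsto_atTop)
  refine ⟨φ₁ ∘ φ₂, tendsto_eLpNorm_of_dominated (w := fun x => C * w x) hq
    (fun n => (hm _ _).mul hw.1) (hw.const_mul C) (fun n x => ?_) ?_⟩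
  · rw [abs_mul, abs_mul]
    exact mul_le_mul_of_nonneg_right ((hC _ _).trans (le_abs_self C)) (abs_nonneg _)
  · filter_upwards [ha, hb, hlim] with x hax hbx hx
    have := hx.comp ((hax.comp h₂.tendsto_atTop).prodMk_nhds hbx)
    simpa using this.mul_const (w x)

theorem tendsto_eLpNorm_bounded_mul_zero {p q : ℝ≥0∞} [Fact (1 ≤ p)] (hq : q ≠ ∞)
    {w : X → ℝ} (hw : MemLp w q μ) {Φ : X → ℝ → ℝ} {C : ℝ} (hC : ∀ x s, |Φ x s| ≤ C)
    (hlim : ∀ x, Tendsto (Φ x) (𝓝 0) (𝓝 0))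
    (hm : ∀ u : Lp ℝ p μ, AEStronglyMeasurable (fun x => Φ x (u x)) μ) :
    Tendsto (fun u : Lp ℝ p μ => eLpNorm (fun x => Φ x (u x) * w x) q μ) (𝓝 0) (𝓝 0) := by
  have hae : ∀ᵐ x ∂μ, Tendsto (fun s : ℝ × ℝ => Φ x s.1)
      (𝓝 ((0 : Lp ℝ p μ) x, (0 : Lp ℝ p μ) x)) (𝓝 0) := by
    filter_upwards [Lp.coeFn_zero ℝ p μ] with x hx
    rw [hx, Pi.zero_apply]
    exact (hlim x).comp (continuous_fst.tendsto ((0 : ℝ), (0 : ℝ)))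
  have hu : Tendsto (fun u : Lp ℝ p μ => (u, (0 : Lp ℝ p μ))) (𝓝 0) (𝓝 (0, 0)) :=
    tendsto_id.prodMk_nhds tendsto_const_nhds
  have key := tendsto_eLpNorm_bounded_mul hq hw (Φ := fun x s => Φ x s.1)
    (fun x s => hC _ _) hae fun u _ => hm u
  have := key.comp hu
  simpa only [Function.comp_def] using this

theorem MeasureTheory.MemLp.bounded_mul {q : ℝ≥0∞} {f w : X → ℝ} {C : ℝ}
    (hw : MemLp w q μ) (hf : AEStronglyMeasurable f μ) (hC : ∀ x, |f x| ≤ C) :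
    MemLp (fun x => f x * w x) q μ :=
  hw.of_le_mul (hf.mul hw.1) (.of_forall fun x => by
    rw [norm_mul]; exact mul_le_mul_of_nonneg_right (hC x) (norm_nonneg _))


theorem norm_lpMk_le {p : ℝ≥0∞} {f : X → ℝ} {g : Lp ℝ p μ} {C : ℝ}
    (h : MemLp f p μ) (hfg : ∀ᵐ x ∂μ, |f x| ≤ C * |g x|) : ‖lpMk p μ f‖ ≤ C * ‖g‖ :=
  Lp.norm_le_mul_norm_of_ae_le_mul (by
    filter_upwards [coeFn_lpMk h, hfg] with x h₁ h₂
    simpa [h₁] using h₂)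

theorem tendsto_norm_lpMk_zero {ι : Type*} {l : Filter ι} {p : ℝ≥0∞} {f : ι → X → ℝ}
    (h : ∀ i, MemLp (f i) p μ) (hf : Tendsto (fun i => eLpNorm (f i) p μ) l (𝓝 0)) :
    Tendsto (fun i => ‖lpMk p μ (f i)‖) l (𝓝 0) := by
  have := (ENNReal.tendsto_toReal ENNReal.zero_ne_top).comp hf
  refine this.congr fun i => ?_
  rw [Function.comp_apply, ← enorm_lpMk (h i), Lp.enorm_def, Lp.norm_def]

theorem continuous_lpMk_bounded_mul {p q : ℝ≥0∞} [Fact (1 ≤ p)] [Fact (1 ≤ q)] (hq : q ≠ ∞)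
    {φ : ℝ × ℝ → ℝ} (hφ : Continuous φ) {C : ℝ} (hC : ∀ s, |φ s| ≤ C)
    {W : Lp ℝ p μ × Lp ℝ p μ → Lp ℝ q μ} (hW : Continuous W) :
    Continuous fun e : Lp ℝ p μ × Lp ℝ p μ => lpMk q μ fun x => φ (e.1 x, e.2 x) * W e x := by
  have hφm : ∀ e : Lp ℝ p μ × Lp ℝ p μ, AEStronglyMeasurable (fun x => φ (e.1 x, e.2 x)) μ :=
    fun e => hφ.comp_aestronglyMeasurable
      ((Lp.aestronglyMeasurable e.1).prodMk (Lp.aestronglyMeasurable e.2))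
  have hmem : ∀ e e' : Lp ℝ p μ × Lp ℝ p μ,
      MemLp (fun x => φ (e.1 x, e.2 x) * W e' x) q μ := fun e e' =>
    (Lp.memLp _).bounded_mul (hφm e) fun x => hC _
  refine continuous_iff_continuousAt.2 fun e₀ => ?_
  rw [ContinuousAt, tendsto_iff_norm_sub_tendsto_zero]
  have hmem₁ : ∀ e : Lp ℝ p μ × Lp ℝ p μ,
      MemLp (fun x => φ (e.1 x, e.2 x) * (W e - W e₀) x) q μ := fun e =>
    (Lp.memLp _).bounded_mul (hφm e) fun x => hC _
  have hbd : ∀ (x : X) (s : ℝ × ℝ), |φ s - φ (e₀.1 x, e₀.2 x)| ≤ C + C := fun x s =>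
    (abs_sub _ _).trans (add_le_add (hC _) (hC _))
  have hmem₂ : ∀ e : Lp ℝ p μ × Lp ℝ p μ,
      MemLp (fun x => (φ (e.1 x, e.2 x) - φ (e₀.1 x, e₀.2 x)) * W e₀ x) q μ := fun e =>
    (Lp.memLp _).bounded_mul ((hφm e).sub (hφm e₀)) fun x => hbd x _
  have h₁ : Tendsto (fun e => C * ‖W e - W e₀‖) (𝓝 e₀) (𝓝 0) := by
    simpa using (tendsto_iff_norm_sub_tendsto_zero.1 (hW.tendsto e₀)).const_mul C
  have h₂ : Tendsto (fun e : Lp ℝ p μ × Lp ℝ p μ =>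
      ‖lpMk q μ fun x => (φ (e.1 x, e.2 x) - φ (e₀.1 x, e₀.2 x)) * W e₀ x‖) (𝓝 e₀) (𝓝 0) := by
    refine tendsto_norm_lpMk_zero hmem₂ (tendsto_eLpNorm_bounded_mul hq (Lp.memLp _)
      (Φ := fun x s => φ s - φ (e₀.1 x, e₀.2 x)) hbd (.of_forall fun x => ?_)
      fun a b => (hφm (a, b)).sub (hφm e₀))
    simpa using (hφ.tendsto (e₀.1 x, e₀.2 x)).sub_const (φ (e₀.1 x, e₀.2 x))
  refine squeeze_zero (fun _ => norm_nonneg _) (fun e => ?_) (by simpa using h₁.add h₂)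
  have hsplit : (lpMk q μ fun x => φ (e.1 x, e.2 x) * W e x) -
      (lpMk q μ fun x => φ (e₀.1 x, e₀.2 x) * W e₀ x) =
      (lpMk q μ fun x => φ (e.1 x, e.2 x) * (W e - W e₀) x) +
      lpMk q μ fun x => (φ (e.1 x, e.2 x) - φ (e₀.1 x, e₀.2 x)) * W e₀ x := by
    refine Lp.ext ?_
    filter_upwards [Lp.coeFn_sub (lpMk q μ fun x => φ (e.1 x, e.2 x) * W e x)
      (lpMk q μ fun x => φ (e₀.1 x, e₀.2 x) * W e₀ x), Lp.coeFn_add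
      (lpMk q μ fun x => φ (e.1 x, e.2 x) * (W e - W e₀) x)
      (lpMk q μ fun x => (φ (e.1 x, e.2 x) - φ (e₀.1 x, e₀.2 x)) * W e₀ x),
      coeFn_lpMk (hmem e e), coeFn_lpMk (hmem e₀ e₀), coeFn_lpMk (hmem₁ e), coeFn_lpMk (hmem₂ e),
      Lp.coeFn_sub (W e) (W e₀)] with x h₁ h₂ h₃ h₄ h₅ h₆ h₇
    rw [h₁, h₂, Pi.sub_apply, Pi.add_apply, h₃, h₄, h₅, h₆, h₇, Pi.sub_apply]
    ring
  rw [hsplit]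
  refine (norm_add_le _ _).trans (add_le_add_left
    (norm_lpMk_le (hmem₁ e) (.of_forall fun x => ?_)) _)
  rw [abs_mul]
  exact mul_le_mul_of_nonneg_right (hC _) (abs_nonneg _)

theorem memLp_comp_of_abs_sub_le [IsFiniteMeasure μ] {p q : ℝ≥0∞} (hqp : q ≤ p) {F : ℝ → ℝ}
    {C : ℝ} (hF : ∀ x y, |F x - F y| ≤ C * |x - y|) (hFc : Continuous F) (a : Lp ℝ p μ) :
    MemLp (fun x => F (a x)) q μ := by
  refine MemLp.mono_exponent ?_ hqp
  have h : MemLp (fun x => F (a x) - F 0) p μ :=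
    (Lp.memLp a).of_le_mul ((hFc.comp_aestronglyMeasurable (Lp.aestronglyMeasurable a)).sub
      aestronglyMeasurable_const) (.of_forall fun x => by simpa using hF (a x) 0)
  simpa [Pi.add_def] using h.add (memLp_const (F 0))

theorem continuous_lpMk_comp [IsProbabilityMeasure μ] {p q : ℝ≥0∞} [Fact (1 ≤ p)] [Fact (1 ≤ q)]
    (hqp : q ≤ p) {F : ℝ → ℝ} {C : ℝ} (hF : ∀ x y, |F x - F y| ≤ C * |x - y|)
    (hFc : Continuous F) : Continuous fun a : Lp ℝ p μ => lpMk q μ fun x => F (a x) := by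
  have hmem := memLp_comp_of_abs_sub_le (μ := μ) hqp hF hFc
  have hC : 0 ≤ C := by simpa using (abs_nonneg _).trans (hF 1 0)
  refine (LipschitzWith.of_dist_le_mul (K := C.toNNReal) fun a b => ?_).continuous
  have hab : MemLp (a - b) q μ := (Lp.memLp (a - b)).mono_exponent hqp
  rw [dist_eq_norm, dist_eq_norm, Real.coe_toNNReal _ hC]
  have h₁ : ‖(lpMk q μ fun x => F (a x)) - lpMk q μ fun x => F (b x)‖ ≤ C * ‖hab.toLp‖ := by
    refine Lp.norm_le_mul_norm_of_ae_le_mul ?_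
    filter_upwards [Lp.coeFn_sub (lpMk q μ fun x => F (a x)) (lpMk q μ fun x => F (b x)),
      coeFn_lpMk (hmem a), coeFn_lpMk (hmem b), hab.coeFn_toLp, Lp.coeFn_sub a b]
      with x h₁ h₂ h₃ h₄ h₅
    rw [h₁, h₄, Pi.sub_apply, h₂, h₃, h₅, Pi.sub_apply]
    exact hF _ _
  refine h₁.trans (mul_le_mul_of_nonneg_left ?_ hC)
  rw [Lp.norm_toLp, Lp.norm_def]
  exact ENNReal.toReal_mono (Lp.eLpNorm_ne_top _) (eLpNorm_le_eLpNorm_of_exponent_le hqp hab.1)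

theorem abs_sub_le_of_abs_deriv_le {F F' : ℝ → ℝ} {C : ℝ} (hF : ∀ x, HasDerivAt F (F' x) x)
    (hC : ∀ x, |F' x| ≤ C) (x y : ℝ) : |F x - F y| ≤ C * |x - y| :=
  convex_univ.norm_image_sub_le_of_norm_hasDerivWithin_le
    (fun x _ => (hF x).hasDerivWithinAt) (fun x _ => hC x) (mem_univ y) (mem_univ x)

/-- The first-order remainder of a function with bounded continuous derivative, divided by the
increment, is bounded and tends to zero with the increment. -/
theorem exists_bounded_remainder {F F' : ℝ → ℝ} {C : ℝ}
    (hF : ∀ x, HasDerivAt F (F' x) x) (hF' : Continuous F') (hC : ∀ x, |F' x| ≤ C) :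
    ∃ h : ℝ → ℝ → ℝ, Measurable (Function.uncurry h) ∧
      (∀ y s, F (y + s) - F y - F' y * s = h y s * s) ∧ (∀ y s, |h y s| ≤ C + C) ∧
      ∀ y, Tendsto (h y) (𝓝 0) (𝓝 0) := by
  set h : ℝ → ℝ → ℝ := fun y s => s⁻¹ * (F (y + s) - F y) - if s = 0 then 0 else F' y with hh
  have h_mul : ∀ y s, F (y + s) - F y - F' y * s = h y s * s := fun y s => by
    rcases eq_or_ne s 0 with rfl | hs
    · simp
    · simp only [hh, if_neg hs]
      field_simp
  have hC0 : 0 ≤ C := (abs_nonneg _).trans (hC 0)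
  have h_bd : ∀ y s, |h y s| ≤ C + C := fun y s => by
    rcases eq_or_ne s 0 with rfl | hs
    · simpa [hh] using hC0
    · simp only [hh, if_neg hs]
      refine (abs_sub _ _).trans (add_le_add ?_ (hC y))
      have := abs_sub_le_of_abs_deriv_le hF hC (y + s) y
      rw [add_sub_cancel_left] at this
      rwa [abs_mul, abs_inv, inv_mul_le_iff₀ (abs_pos.2 hs), mul_comm]
  have h_lim : ∀ y, Tendsto (h y) (𝓝 0) (𝓝 0) := fun y => by
    have h0 : h y 0 = 0 := by simp [hh]
    nth_rewrite 1 [← nhdsNE_sup_pure]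
    rw [tendsto_sup]
    refine ⟨?_, by rw [tendsto_pure_left]; intro s hs; rw [h0]; exact mem_of_mem_nhds hs⟩
    have := ((hasDerivAt_iff_tendsto_slope_zero.1 (hF y)).sub_const (F' y))
    rw [sub_self] at this
    refine this.congr' ?_
    filter_upwards [self_mem_nhdsWithin] with s hs
    simp only [hh, if_neg (show s ≠ 0 from hs), smul_eq_mul]
  have hFm : Measurable F := (continuous_iff_continuousAt.2 fun x => (hF x).continuousAt).measurable
  have h_meas : Measurable (Function.uncurry h) := by
    refine Measurable.sub ?_ (Measurable.ite (measurableSet_eq_fun measurable_snd measurable_const)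
      measurable_const (hF'.measurable.comp measurable_fst))
    exact measurable_snd.inv.mul ((hFm.comp (measurable_fst.add measurable_snd)).sub
      (hFm.comp measurable_fst))
  exact ⟨h, h_meas, h_mul, h_bd, h_lim⟩

theorem hasFDerivAt_lpMk_comp_mul {p q r : ℝ≥0∞} [Fact (1 ≤ p)] [Fact (1 ≤ q)] [Fact (1 ≤ r)]
    [ENNReal.HolderTriple q p r] (hq : q ≠ ∞) {F F' : ℝ → ℝ} {C : ℝ}
    (hF : ∀ x, HasDerivAt F (F' x) x) (hF' : Continuous F') (hC : ∀ x, |F' x| ≤ C)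
    {w : X → ℝ} (hw : MemLp w q μ) (hFw : ∀ a : Lp ℝ p μ, MemLp (fun x => F (a x) * w x) r μ)
    (a : Lp ℝ p μ) :
    HasFDerivAt (fun a : Lp ℝ p μ => lpMk r μ fun x => F (a x) * w x)
      ((ContinuousLinearMap.mul ℝ ℝ).holderL μ q p r (lpMk q μ fun x => F' (a x) * w x)) a := by
  obtain ⟨h, h_meas, h_mul, h_bd, h_lim⟩ := exists_bounded_remainder hF hF' hC
  have h_ae : ∀ u : Lp ℝ p μ, AEStronglyMeasurable (fun x => h (a x) (u x)) μ := fun u =>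
    (h_meas.comp_aemeasurable ((Lp.aestronglyMeasurable a).aemeasurable.prodMk
      (Lp.aestronglyMeasurable u).aemeasurable)).aestronglyMeasurable
  have hmem : ∀ u : Lp ℝ p μ, MemLp (fun x => h (a x) (u x) * w x) q μ := fun u =>
    hw.bounded_mul (h_ae u) fun x => h_bd _ _
  have hmem' : MemLp (fun x => F' (a x) * w x) q μ :=
    hw.bounded_mul (hF'.comp_aestronglyMeasurable (Lp.aestronglyMeasurable a)) fun x => hC _
  have hrem : ∀ u : Lp ℝ p μ, (lpMk r μ fun x => F ((a + u) x) * w x) -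
      (lpMk r μ fun x => F (a x) * w x) -
      (ContinuousLinearMap.mul ℝ ℝ).holderL μ q p r (lpMk q μ fun x => F' (a x) * w x) u =
      (ContinuousLinearMap.mul ℝ ℝ).holder r (lpMk q μ fun x => h (a x) (u x) * w x) u := by
    intro u
    rw [ContinuousLinearMap.holderL_apply_apply]
    refine Lp.ext ?_
    filter_upwards [Lp.coeFn_sub ((lpMk r μ fun x => F ((a + u) x) * w x) -
        (lpMk r μ fun x => F (a x) * w x)) ((ContinuousLinearMap.mul ℝ ℝ).holder r
          (lpMk q μ fun x => F' (a x) * w x) u),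
      Lp.coeFn_sub (lpMk r μ fun x => F ((a + u) x) * w x) (lpMk r μ fun x => F (a x) * w x),
      coeFn_lpMk (hFw (a + u)), coeFn_lpMk (hFw a), coeFn_lpMk (hmem u), coeFn_lpMk hmem',
      (ContinuousLinearMap.mul ℝ ℝ).coeFn_holder (r := r) (lpMk q μ fun x => F' (a x) * w x) u,
      (ContinuousLinearMap.mul ℝ ℝ).coeFn_holder (r := r)
        (lpMk q μ fun x => h (a x) (u x) * w x) u,
      Lp.coeFn_add a u] with x h₁ h₂ h₃ h₄ h₅ h₆ h₇ h₈ h₉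
    rw [h₁, Pi.sub_apply, h₂, Pi.sub_apply, h₃, h₄, h₇, h₈, h₅, h₆, h₉, Pi.add_apply,
      ContinuousLinearMap.mul_apply', ContinuousLinearMap.mul_apply']
    linear_combination w x * h_mul (a x) (u x)
  have hlim : Tendsto (fun u : Lp ℝ p μ => ‖lpMk q μ fun x => h (a x) (u x) * w x‖)
      (𝓝 0) (𝓝 0) := by
    refine tendsto_norm_lpMk_zero hmem ?_
    exact tendsto_eLpNorm_bounded_mul_zero hq hw (fun x s => h_bd _ _) (fun x => h_lim _) h_ae
  rw [hasFDerivAt_iff_isLittleO_nhds_zero, Asymptotics.isLittleO_iff]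
  intro ε hε
  filter_upwards [hlim.eventually (ge_mem_nhds hε)] with u hu
  rw [hrem]
  refine (ContinuousLinearMap.norm_holder_apply_apply_le _ _ _).trans ?_
  refine mul_le_mul_of_nonneg_right ?_ (norm_nonneg _)
  refine (mul_le_of_le_one_left (norm_nonneg _) ?_).trans hu
  exact ContinuousLinearMap.opNorm_mul_le ℝ ℝ

theorem lpMk_congr {p : ℝ≥0∞} {f g : X → ℝ} (h : f =ᵐ[μ] g) : lpMk p μ f = lpMk p μ g := by
  have hfg := memLp_congr_ae (p := p) h
  by_cases hf : MemLp f p μ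
  · rw [lpMk, lpMk, dif_pos hf, dif_pos (hfg.1 hf)]
    exact MemLp.toLp_congr _ _ h
  · rw [lpMk, lpMk, dif_neg hf, dif_neg (mt hfg.2 hf)]

/-- The exponent `L / (L - n)`, which is such that the product of a function in `L^(L / (L - n))`
and `n` functions in `L^L` is integrable. -/
noncomputable def complExponent (L : ℝ≥0∞) : ℕ → ℝ≥0∞
  | 0 => 1
  | n + 1 => (1 - (n + 1 : ℕ) / L)⁻¹

theorem inv_complExponent (L : ℝ≥0∞) (n : ℕ) : (complExponent L n)⁻¹ = 1 - n / L := by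
  cases n <;> simp [complExponent]

instance fact_one_le_complExponent (L : ℝ≥0∞) (n : ℕ) : Fact (1 ≤ complExponent L n) :=
  ⟨by rw [← ENNReal.inv_le_inv, inv_complExponent]; simp⟩

theorem complExponent_ne_top {L : ℝ≥0∞} {n : ℕ} (h : (n : ℝ≥0∞) < L) :
    complExponent L n ≠ ∞ := by
  rw [← ENNReal.inv_ne_zero, inv_complExponent]
  refine (tsub_pos_of_lt ?_).ne'
  refine ENNReal.div_lt_of_lt_mul ?_
  simpa using h

theorem inv_add_div_le_one {L : ℝ≥0∞} {n : ℕ} (h : (n : ℝ≥0∞) + 1 ≤ L) :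
    L⁻¹ + n / L ≤ 1 := by
  rw [← one_div, ENNReal.div_add_div_same, add_comm]
  exact ENNReal.div_le_of_le_mul (by simpa using h)

theorem natCast_div_ne_top {L : ℝ≥0∞} {n : ℕ} (h : (n : ℝ≥0∞) + 1 ≤ L) : (n : ℝ≥0∞) / L ≠ ∞ :=
  ne_top_of_le_ne_top ENNReal.one_ne_top (le_add_self.trans (inv_add_div_le_one h))

theorem complExponent_le {L : ℝ≥0∞} {n : ℕ} (h : (n : ℝ≥0∞) + 1 ≤ L) :
    complExponent L n ≤ L := by
  rw [← ENNReal.inv_le_inv, inv_complExponent]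
  exact ENNReal.le_sub_of_add_le_right (natCast_div_ne_top h) (inv_add_div_le_one h)

theorem holderTriple_complExponent {L : ℝ≥0∞} {n : ℕ} (h : (n : ℝ≥0∞) + 1 ≤ L) :
    ENNReal.HolderTriple (complExponent L (n + 1)) L (complExponent L n) := by
  constructor
  rw [inv_complExponent, inv_complExponent, Nat.cast_add, Nat.cast_one, ENNReal.add_div,
    one_div, tsub_add_eq_tsub_tsub]
  exact tsub_add_cancel_of_le
    (ENNReal.le_sub_of_add_le_right (natCast_div_ne_top h) (inv_add_div_le_one h))

open Classical in
/-- Pointwise multiplication `L^(L / (L - (n + 1))) × L^L → L^(L / (L - n))`. -/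
noncomputable def lpMulCompl (L : ℝ≥0∞) [Fact (1 ≤ L)] (μ : Measure X) (n : ℕ) :
    Lp ℝ (complExponent L (n + 1)) μ →L[ℝ] Lp ℝ L μ →L[ℝ] Lp ℝ (complExponent L n) μ :=
  if _h : ENNReal.HolderTriple (complExponent L (n + 1)) L (complExponent L n) then
    (ContinuousLinearMap.mul ℝ ℝ).holderL μ _ L _ else 0

theorem lpMulCompl_eq {L : ℝ≥0∞} [Fact (1 ≤ L)] {n : ℕ}
    [ENNReal.HolderTriple (complExponent L (n + 1)) L (complExponent L n)] :
    lpMulCompl L μ n = (ContinuousLinearMap.mul ℝ ℝ).holderL μ _ L _ := dif_pos _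

theorem coeFn_lpMulCompl {L : ℝ≥0∞} [Fact (1 ≤ L)] {n : ℕ} (h : (n : ℝ≥0∞) + 1 ≤ L)
    (c : Lp ℝ (complExponent L (n + 1)) μ) (u : Lp ℝ L μ) :
    lpMulCompl L μ n c u =ᵐ[μ] fun x => c x * u x := by
  have := holderTriple_complExponent h
  rw [lpMulCompl_eq, ContinuousLinearMap.holderL_apply_apply]
  exact (ContinuousLinearMap.mul ℝ ℝ).coeFn_holder c u

/-- The identity map, `complExponent L 0` being definitionally equal to `1`. -/
noncomputable def lpComplZero (L : ℝ≥0∞) (μ : Measure X) :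
    Lp ℝ (complExponent L 0) μ →L[ℝ] Lp ℝ 1 μ :=
  ContinuousLinearMap.id ℝ (Lp ℝ 1 μ)

/-- The multilinear map `u ↦ c * ∏ k, u k` from `L^L` to `L^1`. -/
noncomputable def lpMulMultilinear (L : ℝ≥0∞) [Fact (1 ≤ L)] (μ : Measure X) (n : ℕ) :
    Lp ℝ (complExponent L n) μ →L[ℝ]
      ContinuousMultilinearMap ℝ (fun _ : Fin n => Lp ℝ L μ) (Lp ℝ 1 μ) :=
  iteratedBilin (Z := fun n => Lp ℝ (complExponent L n) μ) (lpMulCompl L μ)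
    (lpComplZero L μ) n

theorem coeFn_lpMulMultilinear {L : ℝ≥0∞} [Fact (1 ≤ L)] {n : ℕ} (h : (n : ℝ≥0∞) ≤ L)
    (c : Lp ℝ (complExponent L n) μ) (u : Fin n → Lp ℝ L μ) :
    lpMulMultilinear L μ n c u =ᵐ[μ] fun x => c x * ∏ k, u k x := by
  induction n with
  | zero =>
    refine .of_forall fun x => ?_
    simp only [Finset.univ_eq_empty, Finset.prod_empty, mul_one]
    rfl
  | succ n ih =>
    rw [Nat.cast_add, Nat.cast_one] at h
    filter_upwards [ih (le_self_add.trans h) (lpMulCompl L μ n c (u 0)) (Fin.tail u),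
      coeFn_lpMulCompl h c (u 0)] with x h₁ h₂
    rw [lpMulMultilinear, iteratedBilin_succ_apply]
    rw [lpMulMultilinear] at h₁
    rw [h₁, h₂, Fin.prod_univ_succ, mul_assoc]
    rfl

/-- The multilinear map `v ↦ u ↦ c * (∏ k, u k) * ∏ k, v k` from `L^L` to `L^1`. -/
noncomputable def lpMulMultilinear₂ (L : ℝ≥0∞) [Fact (1 ≤ L)] (μ : Measure X) (i j : ℕ) :
    Lp ℝ (complExponent L (i + j)) μ →L[ℝ]
      ContinuousMultilinearMap ℝ (fun _ : Fin j => Lp ℝ L μ)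
        (ContinuousMultilinearMap ℝ (fun _ : Fin i => Lp ℝ L μ) (Lp ℝ 1 μ)) :=
  iteratedBilin (Z := fun j => Lp ℝ (complExponent L (i + j)) μ) (fun j => lpMulCompl L μ (i + j))
    (lpMulMultilinear L μ i) j

theorem coeFn_lpMulMultilinear₂ {L : ℝ≥0∞} [Fact (1 ≤ L)] {i j : ℕ}
    (h : ((i + j : ℕ) : ℝ≥0∞) ≤ L) (c : Lp ℝ (complExponent L (i + j)) μ)
    (u : Fin i → Lp ℝ L μ) (v : Fin j → Lp ℝ L μ) :
    lpMulMultilinear₂ L μ i j c v u =ᵐ[μ] fun x => c x * (∏ k, u k x) * ∏ k, v k x := by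
  induction j with
  | zero =>
    simp only [Finset.univ_eq_empty, Finset.prod_empty, mul_one]
    exact coeFn_lpMulMultilinear h c u
  | succ j ih =>
    rw [← add_assoc, Nat.cast_add, Nat.cast_one] at h
    filter_upwards [ih (le_self_add.trans h) (lpMulCompl L μ (i + j) c (v 0)) (Fin.tail v),
      coeFn_lpMulCompl h c (v 0)] with x h₁ h₂
    rw [lpMulMultilinear₂, iteratedBilin_succ_apply]
    rw [lpMulMultilinear₂] at h₁
    rw [h₁, h₂, Fin.prod_univ_succ]
    simp only [Fin.tail]
    ring

/-- A sequence of functions, each the derivative of the preceding one, all bounded except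
possibly the first one. -/
structure IsBoundedDerivSeq (F : ℕ → ℝ → ℝ) : Prop where
  hasDerivAt : ∀ n x, HasDerivAt (F n) (F (n + 1) x) x
  bounded : ∀ n, ∃ C, ∀ x, |F (n + 1) x| ≤ C

namespace IsBoundedDerivSeq

variable {F G : ℕ → ℝ → ℝ}

theorem continuous (hF : IsBoundedDerivSeq F) (n : ℕ) : Continuous (F n) :=
  continuous_iff_continuousAt.2 fun x => (hF.hasDerivAt n x).continuousAt

theorem exists_lipschitz (hF : IsBoundedDerivSeq F) : ∃ C, ∀ x y, |F 0 x - F 0 y| ≤ C * |x - y| :=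
  (hF.bounded 0).imp fun _ hC => abs_sub_le_of_abs_deriv_le (hF.hasDerivAt 0) hC

theorem iteratedDeriv_eq (hF : IsBoundedDerivSeq F) (n : ℕ) : iteratedDeriv n (F 0) = F n := by
  induction n with
  | zero => exact iteratedDeriv_zero
  | succ n ih =>
    rw [iteratedDeriv_succ, ih]
    exact funext fun x => (hF.hasDerivAt n x).deriv

theorem aestronglyMeasurable_comp (hF : IsBoundedDerivSeq F) (n : ℕ) {p : ℝ≥0∞} (a : Lp ℝ p μ) :
    AEStronglyMeasurable (fun x => F n (a x)) μ :=
  (hF.continuous n).comp_aestronglyMeasurable (Lp.aestronglyMeasurable a)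

/-- Boundedness of a derivative or membership in `L^q` of a composition, for exponents `q ≤ p`. -/
theorem memLp_comp [IsProbabilityMeasure μ] (hF : IsBoundedDerivSeq F) (n : ℕ) {p q : ℝ≥0∞}
    (hqp : q ≤ p ∨ n ≠ 0) (a : Lp ℝ p μ) : MemLp (fun x => F n (a x)) q μ := by
  cases n with
  | zero =>
    obtain ⟨C, hC⟩ := hF.exists_lipschitz
    exact memLp_comp_of_abs_sub_le (hqp.resolve_right (by simp)) hC (hF.continuous 0) a
  | succ n =>
    obtain ⟨C, hC⟩ := hF.bounded n
    exact MemLp.of_bound (hF.aestronglyMeasurable_comp _ a) C (.of_forall fun x => hC _)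

theorem memLp_mul [IsProbabilityMeasure μ] (hF : IsBoundedDerivSeq F) (hG : IsBoundedDerivSeq G)
    {L : ℝ≥0∞} [Fact (1 ≤ L)] (hL : 2 ≤ L) {i j : ℕ} (hi : (i : ℝ≥0∞) + 1 ≤ L)
    (hj : (j : ℝ≥0∞) + 1 ≤ L) (a b : Lp ℝ L μ) :
    MemLp (fun x => F i (a x) * G j (b x)) (complExponent L (i + j)) μ := by
  rcases i with _ | i
  · rcases j with _ | j
    · have : ENNReal.HolderTriple (complExponent L 1) L (complExponent L 0) :=
        holderTriple_complExponent hi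
      have h1 : complExponent L 1 ≤ L := complExponent_le (by norm_num; exact hL)
      exact (hG.memLp_comp 0 (.inl le_rfl) b).mul (hF.memLp_comp 0 (.inl h1) a)
    · obtain ⟨C, hC⟩ := hG.bounded j
      have := (hF.memLp_comp 0 (.inl (complExponent_le hj)) a).bounded_mul
        (hG.aestronglyMeasurable_comp _ b) fun x => hC _
      simpa only [zero_add, mul_comm] using this
  · obtain ⟨C, hC⟩ := hF.bounded i
    rcases j with _ | j
    · exact (hG.memLp_comp 0 (.inl (complExponent_le hi)) b).bounded_mul
        (hF.aestronglyMeasurable_comp _ a) fun x => hC _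
    · exact (hG.memLp_comp (j + 1) (.inr (by simp)) b).bounded_mul
        (hF.aestronglyMeasurable_comp _ a) fun x => hC _

theorem continuous_lpMk_mul_zero [IsProbabilityMeasure μ] (hF : IsBoundedDerivSeq F)
    (hG : IsBoundedDerivSeq G) {p q : ℝ≥0∞} [Fact (1 ≤ p)] [Fact (1 ≤ q)] (hqp : q ≤ p)
    (hq : q ≠ ∞) (n : ℕ) :
    Continuous fun e : Lp ℝ p μ × Lp ℝ p μ =>
      lpMk q μ fun x => F (n + 1) (e.1 x) * G 0 (e.2 x) := by
  obtain ⟨C, hC⟩ := hF.bounded n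
  obtain ⟨K, hK⟩ := hG.exists_lipschitz
  have hW : Continuous fun e : Lp ℝ p μ × Lp ℝ p μ => lpMk q μ fun x => G 0 (e.2 x) :=
    (continuous_lpMk_comp hqp hK (hG.continuous 0)).comp continuous_snd
  have := continuous_lpMk_bounded_mul hq (φ := fun s => F (n + 1) s.1)
    ((hF.continuous _).comp continuous_fst) (fun s => hC _) hW
  refine this.congr fun e => lpMk_congr ?_
  filter_upwards [coeFn_lpMk (hG.memLp_comp 0 (.inl hqp) e.2)] with x hx
  rw [hx]

theorem continuous_lpMk_mul_succ [IsProbabilityMeasure μ] (hF : IsBoundedDerivSeq F)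
    (hG : IsBoundedDerivSeq G) {p q : ℝ≥0∞} [Fact (1 ≤ p)] [Fact (1 ≤ q)] (hq : q ≠ ∞)
    (i j : ℕ) :
    Continuous fun e : Lp ℝ p μ × Lp ℝ p μ =>
      lpMk q μ fun x => F (i + 1) (e.1 x) * G (j + 1) (e.2 x) := by
  obtain ⟨C, hC⟩ := hF.bounded i
  obtain ⟨K, hK⟩ := hG.bounded j
  have hW : Continuous fun _ : Lp ℝ p μ × Lp ℝ p μ => lpMk q μ fun _ => (1 : ℝ) :=
    continuous_const
  have := continuous_lpMk_bounded_mul hq (φ := fun s => F (i + 1) s.1 * G (j + 1) s.2) (C := C * K)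
    (((hF.continuous _).comp continuous_fst).mul ((hG.continuous _).comp continuous_snd))
    (fun s => by
      rw [abs_mul]
      exact mul_le_mul (hC _) (hK _) (abs_nonneg _) ((abs_nonneg _).trans (hC 0))) hW
  refine this.congr fun e => lpMk_congr ?_
  filter_upwards [coeFn_lpMk (memLp_const (μ := μ) (p := q) (1 : ℝ))] with x hx
  rw [hx, mul_one]

theorem continuous_lpMk_mul [IsProbabilityMeasure μ] (hF : IsBoundedDerivSeq F)
    (hG : IsBoundedDerivSeq G) {L : ℝ≥0∞} [Fact (1 ≤ L)] (hL : 2 ≤ L) {i j : ℕ}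
    (hi : (i : ℝ≥0∞) + 1 ≤ L) (hj : (j : ℝ≥0∞) + 1 ≤ L) (hij : ((i + j : ℕ) : ℝ≥0∞) < L) :
    Continuous fun e : Lp ℝ L μ × Lp ℝ L μ =>
      lpMk (complExponent L (i + j)) μ fun x => F i (e.1 x) * G j (e.2 x) := by
  have hq := complExponent_ne_top hij
  rcases i with _ | i
  · rcases j with _ | j
    · have h1 : complExponent L 1 ≤ L := complExponent_le (by norm_num; exact hL)
      obtain ⟨C, hC⟩ := hF.exists_lipschitz
      obtain ⟨K, hK⟩ := hG.exists_lipschitz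
      have hcF := (continuous_lpMk_comp (μ := μ) h1 hC (hF.continuous 0)).comp
        (continuous_fst (Y := Lp ℝ L μ))
      have hcG := (continuous_lpMk_comp (μ := μ) (le_refl L) hK (hG.continuous 0)).comp
        (continuous_snd (X := Lp ℝ L μ))
      have := ((lpMulCompl L μ 0).continuous.comp hcF).clm_apply hcG
      refine this.congr fun e => Lp.ext ?_
      filter_upwards [coeFn_lpMulCompl hi (lpMk (complExponent L 1) μ fun x => F 0 (e.1 x))
        (lpMk L μ fun x => G 0 (e.2 x)), coeFn_lpMk (hF.memLp_mul hG hL hi hj e.1 e.2),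
        coeFn_lpMk (hF.memLp_comp 0 (.inl h1) e.1),
        coeFn_lpMk (hG.memLp_comp 0 (.inl le_rfl) e.2)] with x h₁ h₂ h₃ h₄
      rw [h₂, ← h₃, ← h₄]
      exact h₁
    · have hqL : complExponent L (0 + (j + 1)) ≤ L := by
        rw [zero_add]; exact complExponent_le hj
      have := (hG.continuous_lpMk_mul_zero hF (μ := μ) hqL hq j).comp continuous_swap
      simpa only [Function.comp_def, Prod.fst_swap, Prod.snd_swap, mul_comm] using this
  · rcases j with _ | j
    · exact hF.continuous_lpMk_mul_zero hG (complExponent_le hi) hq i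
    · exact hF.continuous_lpMk_mul_succ hG hq i j

theorem hasFDerivAt_left [IsProbabilityMeasure μ] (hF : IsBoundedDerivSeq F)
    (hG : IsBoundedDerivSeq G) {L : ℝ≥0∞} [Fact (1 ≤ L)] (hL : 2 ≤ L) {i : ℕ}
    (hi : ((i + 1 : ℕ) : ℝ≥0∞) + 1 ≤ L) (hi' : ((i + 1 : ℕ) : ℝ≥0∞) < L) (a b : Lp ℝ L μ) :
    HasFDerivAt (fun a : Lp ℝ L μ => lpMk (complExponent L i) μ fun x => F i (a x) * G 0 (b x))
      (lpMulCompl L μ i (lpMk (complExponent L (i + 1)) μ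
        fun x => F (i + 1) (a x) * G 0 (b x))) a := by
  have hi₁ : (i : ℝ≥0∞) + 1 ≤ L := by simpa using hi'.le
  have := holderTriple_complExponent hi₁
  obtain ⟨C, hC⟩ := hF.bounded i
  rw [lpMulCompl_eq]
  exact hasFDerivAt_lpMk_comp_mul (r := complExponent L i) (complExponent_ne_top hi')
    (hF.hasDerivAt i)
    (hF.continuous _) hC (hG.memLp_comp 0 (.inl (complExponent_le hi)) b)
    (fun a => hF.memLp_mul hG hL hi₁ (j := 0) (by simpa using Fact.out) a b) a

theorem hasFDerivAt_right [IsProbabilityMeasure μ] (hF : IsBoundedDerivSeq F)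
    (hG : IsBoundedDerivSeq G) {L : ℝ≥0∞} [Fact (1 ≤ L)] (hL : 2 ≤ L) {i j : ℕ}
    (hi : (i : ℝ≥0∞) + 1 ≤ L) (hj : ((j + 1 : ℕ) : ℝ≥0∞) + 1 ≤ L)
    (hij : ((i + (j + 1) : ℕ) : ℝ≥0∞) < L) (a b : Lp ℝ L μ) :
    HasFDerivAt
      (fun b : Lp ℝ L μ => lpMk (complExponent L (i + j)) μ fun x => F i (a x) * G j (b x))
      (lpMulCompl L μ (i + j) (lpMk (complExponent L (i + j + 1)) μ
        fun x => F i (a x) * G (j + 1) (b x))) b := by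
  have hij₁ : ((i + j : ℕ) : ℝ≥0∞) + 1 ≤ L := by
    rw [← add_assoc] at hij; exact_mod_cast hij.le
  have hj₁ : (j : ℝ≥0∞) + 1 ≤ L := by push_cast at hj; exact le_self_add.trans hj
  have := holderTriple_complExponent hij₁
  obtain ⟨C, hC⟩ := hG.bounded j
  have hw : MemLp (fun x => F i (a x)) (complExponent L (i + j + 1)) μ := by
    refine hF.memLp_comp i ?_ a
    rcases i with _ | i
    · rw [zero_add]
      exact .inl (complExponent_le hj)
    · exact .inr (by simp)
  rw [lpMulCompl_eq]
  have := hasFDerivAt_lpMk_comp_mul (r := complExponent L (i + j)) (complExponent_ne_top hij)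
    (hG.hasDerivAt j) (hG.continuous _) hC hw
    (fun b => by simpa only [mul_comm] using hF.memLp_mul hG hL hi hj₁ a b) b
  simp only [mul_comm] at this ⊢
  exact this

theorem hasFTaylorSeriesUpTo_left [IsProbabilityMeasure μ] (hF : IsBoundedDerivSeq F)
    (hG : IsBoundedDerivSeq G) {L : ℝ≥0∞} [Fact (1 ≤ L)] (hL : 2 ≤ L) {i : ℕ}
    (hi : (i : ℝ≥0∞) + 1 ≤ L) (hi' : (i : ℝ≥0∞) < L) (b : Lp ℝ L μ) :
    HasFTaylorSeriesUpTo i (fun a : Lp ℝ L μ => lpMk 1 μ fun x => F 0 (a x) * G 0 (b x))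
      (fun a n => lpMulMultilinear L μ n
        (lpMk (complExponent L n) μ fun x => F n (a x) * G 0 (b x))) := by
  refine hasFTaylorSeriesUpTo_iteratedBilin (Z := fun n => Lp ℝ (complExponent L n) μ)
    (lpMulCompl L μ) (lpComplZero L μ)
    (fun n a => lpMk (complExponent L n) μ fun x => F n (a x) * G 0 (b x)) (fun n hn a => ?_) ?_
  · have hn' : ((n + 1 : ℕ) : ℝ≥0∞) ≤ i := by exact_mod_cast hn
    exact hF.hasFDerivAt_left hG hL ((by gcongr : _ ≤ (i : ℝ≥0∞) + 1).trans hi)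
      (hn'.trans_lt hi') a b
  · exact (hF.continuous_lpMk_mul hG hL hi (j := 0) (by simpa using Fact.out)
      (by simpa using hi')).comp (continuous_id.prodMk continuous_const)

theorem hasFTaylorSeriesUpTo_right [IsProbabilityMeasure μ] (hF : IsBoundedDerivSeq F)
    (hG : IsBoundedDerivSeq G) {L : ℝ≥0∞} [Fact (1 ≤ L)] (hL : 2 ≤ L) {i j : ℕ}
    (hi : (i : ℝ≥0∞) + 1 ≤ L) (hj : (j : ℝ≥0∞) + 1 ≤ L) (hij : ((i + j : ℕ) : ℝ≥0∞) < L)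
    (a : Lp ℝ L μ) :
    HasFTaylorSeriesUpTo j (fun b : Lp ℝ L μ => lpMulMultilinear L μ i
        (lpMk (complExponent L i) μ fun x => F i (a x) * G 0 (b x)))
      (fun b n => lpMulMultilinear₂ L μ i n
        (lpMk (complExponent L (i + n)) μ fun x => F i (a x) * G n (b x))) := by
  refine hasFTaylorSeriesUpTo_iteratedBilin (Z := fun n => Lp ℝ (complExponent L (i + n)) μ)
    (fun n => lpMulCompl L μ (i + n)) (lpMulMultilinear L μ i)
    (fun n b => lpMk (complExponent L (i + n)) μ fun x => F i (a x) * G n (b x))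
    (fun n hn b => ?_) ?_
  · have hn' : ((n + 1 : ℕ) : ℝ≥0∞) ≤ j := by exact_mod_cast hn
    have hin : ((i + (n + 1) : ℕ) : ℝ≥0∞) ≤ (i + j : ℕ) := by
      exact_mod_cast Nat.add_le_add_left hn i
    exact hF.hasFDerivAt_right hG hL hi ((by gcongr : _ ≤ (j : ℝ≥0∞) + 1).trans hj)
      (hin.trans_lt hij) a b
  · exact (hF.continuous_lpMk_mul hG hL hi hj hij).comp (continuous_const.prodMk continuous_id)

end IsBoundedDerivSeq

end Nemytskii

section InverseThetaDerivatives

open Polynomial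

variable {ψ : ℝ → ℝ}

theorem continuous_of_add_log_eq (hψ : ∀ z : ℝ, 0 < ψ z ∧ ψ z + Real.log (ψ z) = z) :
    Continuous ψ := by
  have key : ∀ y z, ψ y ≤ ψ z → ψ z - ψ y ≤ |z - y| := fun y z h => by
    have := Real.log_le_log (hψ y).1 h
    refine le_trans ?_ (le_abs_self _)
    linarith [(hψ y).2, (hψ z).2]
  refine (LipschitzWith.of_dist_le_mul (K := 1) fun y z => ?_).continuous
  rw [Real.dist_eq, Real.dist_eq, NNReal.coe_one, one_mul]
  rcases le_total (ψ y) (ψ z) with h | h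
  · rw [abs_sub_comm, abs_of_nonneg (sub_nonneg.2 h), abs_sub_comm]
    exact key y z h
  · rw [abs_of_nonneg (sub_nonneg.2 h)]
    exact key z y h

theorem hasDerivAt_of_add_log_eq (hψ : ∀ z : ℝ, 0 < ψ z ∧ ψ z + Real.log (ψ z) = z) (z : ℝ) :
    HasDerivAt ψ (ψ z / (1 + ψ z)) z := by
  have hpos := (hψ z).1
  have hθ : HasDerivAt (fun y => y + Real.log y) (1 + (ψ z)⁻¹) (ψ z) :=
    (hasDerivAt_id (ψ z)).add (Real.hasDerivAt_log hpos.ne')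
  have := hθ.of_local_left_inverse (continuous_of_add_log_eq hψ).continuousAt (by positivity)
    (.of_forall fun y => (hψ y).2)
  refine this.congr_deriv ?_
  field_simp
  ring

/-- The `n`-th derivative of `ψ ^ β / (1 + ψ)` is this polynomial in `1 / (1 + ψ)` multiplied by
`ψ ^ β / (1 + ψ)`. -/
noncomputable def inverseThetaPoly (β : ℝ) : ℕ → ℝ[X]
  | 0 => 1
  | n + 1 => inverseThetaPoly β n * (C β * X - X * (1 - X)) -
      derivative (inverseThetaPoly β n) * ((1 - X) * X ^ 2)

theorem hasDerivAt_mul_inverseThetaPoly (hψ : ∀ z : ℝ, 0 < ψ z ∧ ψ z + Real.log (ψ z) = z)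
    (β : ℝ) (n : ℕ) (z : ℝ) :
    HasDerivAt (fun z => ψ z ^ β / (1 + ψ z) * (inverseThetaPoly β n).eval (1 + ψ z)⁻¹)
      (ψ z ^ β / (1 + ψ z) * (inverseThetaPoly β (n + 1)).eval (1 + ψ z)⁻¹) z := by
  have hpos := (hψ z).1
  have hne : 1 + ψ z ≠ 0 := by positivity
  have hd := hasDerivAt_of_add_log_eq hψ z
  have hr := (hd.const_add 1).inv hne
  have hs := (hd.rpow_const (p := β) (.inl hpos.ne')).div (hd.const_add 1) hne
  have hp := ((inverseThetaPoly β n).hasDerivAt (1 + ψ z)⁻¹).comp z hr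
  refine (hs.mul hp).congr_deriv ?_
  rw [Real.rpow_sub_one hpos.ne', inverseThetaPoly]
  simp only [eval_sub, eval_mul, eval_C, eval_X, eval_one, eval_pow, Function.comp_apply,
    Pi.div_apply, Pi.inv_apply]
  field_simp
  ring

theorem exists_isBoundedDerivSeq (hψ : ∀ z : ℝ, 0 < ψ z ∧ ψ z + Real.log (ψ z) = z)
    {β : ℝ} (hβ : β ∈ Icc (0 : ℝ) 1) {ξ : ℝ → ℝ}
    (hξ : ∀ z, HasDerivAt ξ (ψ z ^ β / (1 + ψ z)) z) :
    ∃ F, IsBoundedDerivSeq F ∧ F 0 = ξ := by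
  refine ⟨fun n z => Nat.casesOn n (ξ z) fun n =>
    ψ z ^ β / (1 + ψ z) * (inverseThetaPoly β n).eval (1 + ψ z)⁻¹,
    ⟨fun n z => ?_, fun n => ?_⟩, rfl⟩
  · cases n with
    | zero => simpa [inverseThetaPoly] using hξ z
    | succ n => exact hasDerivAt_mul_inverseThetaPoly hψ β n z
  · obtain ⟨K, hK⟩ := (isCompact_Icc (a := (0 : ℝ)) (b := 1)).exists_bound_of_continuousOn
      (inverseThetaPoly β n).continuous.continuousOn
    refine ⟨1 * K, fun z => ?_⟩
    have hpos := (hψ z).1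
    have hle : ψ z ^ β ≤ 1 + ψ z := by
      have h₁ : ψ z ^ β ≤ (1 + ψ z) ^ β :=
        Real.rpow_le_rpow hpos.le (by linarith) hβ.1
      have h₂ := Real.rpow_le_rpow_of_exponent_le (x := 1 + ψ z) (by linarith) hβ.2
      rw [Real.rpow_one] at h₂
      exact h₁.trans h₂
    have hr : (1 + ψ z)⁻¹ ∈ Icc (0 : ℝ) 1 :=
      ⟨by positivity, inv_le_one_of_one_le₀ (by linarith)⟩
    change |ψ z ^ β / (1 + ψ z) * _| ≤ _
    rw [abs_mul, abs_of_nonneg (by positivity : 0 ≤ ψ z ^ β / (1 + ψ z))]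
    exact mul_le_mul (div_le_one_of_le₀ hle (by positivity)) (hK _ hr) (abs_nonneg _) zero_le_one

theorem exists_isBoundedDerivSeq_xi (hψ : ∀ z : ℝ, 0 < ψ z ∧ ψ z + Real.log (ψ z) = z)
    {γ : ℝ} (hγ : γ ∈ Icc (-1 : ℝ) 1) {ξ : ℝ → ℝ}
    (hξ : ∀ z, ξ z = if γ = 1 then z - ψ z else (2 / (1 - γ)) * ψ z ^ ((1 - γ) / 2)) :
    ∃ F, IsBoundedDerivSeq F ∧ F 0 = ξ := by
  refine exists_isBoundedDerivSeq (β := (1 - γ) / 2) hψ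
    ⟨by linarith [hγ.2], by linarith [hγ.1]⟩ fun z => ?_
  have hpos := (hψ z).1
  have hd := hasDerivAt_of_add_log_eq hψ z
  rw [funext hξ]
  by_cases h : γ = 1
  · simp only [h, if_true, sub_self, zero_div, Real.rpow_zero]
    refine ((hasDerivAt_id z).sub hd).congr_deriv ?_
    field_simp
    ring
  · simp only [if_neg h]
    have h' : 1 - γ ≠ 0 := sub_ne_zero.2 (Ne.symm h)
    refine ((hd.rpow_const (p := (1 - γ) / 2) (.inl hpos.ne')).const_mul
      (2 / (1 - γ))).congr_deriv ?_
    rw [Real.rpow_sub_one hpos.ne']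
    field_simp

end InverseThetaDerivatives

/-- Lemma 4.1: for `α ∈ [−1,1]`, the map
`Υ_α : L^λ(μ) × L^λ(μ) → L¹(μ)`, `Υ_α(ã,b̃) = ξ_α(ã)·ξ_{−α}(b̃)`, is of class `C^{i,j}`
for all `0 ≤ i,j ≤ ⌊λ⌋−1` with `i+j ≤ ⌈λ⌉−1`, and its partial Fréchet derivative
`D₁^iD₂^jΥ_{α,ã,b̃}` is the continuous `(i+j)`-linear map
`(ũ₁,…,ũ_i;ṽ₁,…,ṽ_j) ↦ ξ_α^{(i)}(ã) ξ_{−α}^{(j)}(b̃) ũ₁⋯ũ_i ṽ₁⋯ṽ_j`. -/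
theorem stmt_13 {X : Type*} [MeasurableSpace X] (μ : Measure X) [IsProbabilityMeasure μ]
    (lam : ℝ) (hlam : 2 ≤ lam) [Fact (1 ≤ ENNReal.ofReal lam)]
    (ψ : ℝ → ℝ) (hψ : ∀ z : ℝ, 0 < ψ z ∧ ψ z + Real.log (ψ z) = z)
    (α : ℝ) (hα : α ∈ Icc (-1 : ℝ) 1)
    (ξa ξb : ℝ → ℝ)
    (hξa : ∀ z : ℝ, ξa z =
      if α = 1 then z - ψ z else (2 / (1 - α)) * ψ z ^ ((1 - α) / 2))
    (hξb : ∀ z : ℝ, ξb z =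
      if α = -1 then z - ψ z else (2 / (1 + α)) * ψ z ^ ((1 + α) / 2)) :
    ∃ Υ : Lp ℝ (ENNReal.ofReal lam) μ → Lp ℝ (ENNReal.ofReal lam) μ → Lp ℝ 1 μ,
      (∀ a b : Lp ℝ (ENNReal.ofReal lam) μ,
        Υ a b =ᵐ[μ] fun x => ξa (a x) * ξb (b x)) ∧
      ∀ i j : ℕ, (i : ℤ) ≤ ⌊lam⌋ - 1 → (j : ℤ) ≤ ⌊lam⌋ - 1 →
          (i + j : ℤ) ≤ ⌈lam⌉ - 1 →
        -- Υ is i times continuously differentiable in its first variable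
        (∀ b : Lp ℝ (ENNReal.ofReal lam) μ, ContDiff ℝ i (fun a => Υ a b)) ∧
        -- D₁^iΥ is j times continuously differentiable in the second variable
        (∀ a : Lp ℝ (ENNReal.ofReal lam) μ,
          ContDiff ℝ j (fun b => iteratedFDeriv ℝ i (fun a' => Υ a' b) a)) ∧
        -- joint continuity of the mixed partial derivative D₁^iD₂^jΥ
        (Continuous fun q : Lp ℝ (ENNReal.ofReal lam) μ × Lp ℝ (ENNReal.ofReal lam) μ =>
          iteratedFDeriv ℝ j (fun b => iteratedFDeriv ℝ i (fun a' => Υ a' b) q.1) q.2) ∧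
        -- the formula for D₁^iD₂^jΥ
        (∀ (a b : Lp ℝ (ENNReal.ofReal lam) μ)
            (u : Fin i → Lp ℝ (ENNReal.ofReal lam) μ)
            (v : Fin j → Lp ℝ (ENNReal.ofReal lam) μ),
          (iteratedFDeriv ℝ j (fun b' => iteratedFDeriv ℝ i (fun a' => Υ a' b') a) b v u
              : Lp ℝ 1 μ) =ᵐ[μ]
            fun x => iteratedDeriv i ξa (a x) * iteratedDeriv j ξb (b x) *
              (∏ k, u k x) * (∏ k, v k x)) := by
  obtain ⟨F, hF, rfl⟩ := exists_isBoundedDerivSeq_xi hψ hα hξa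
  obtain ⟨G, hG, rfl⟩ := exists_isBoundedDerivSeq_xi (γ := -α) (ξ := ξb) hψ
    ⟨by linarith [hα.2], by linarith [hα.1]⟩
    (by simpa only [sub_neg_eq_add, neg_eq_iff_eq_neg] using hξb)
  have hL : (2 : ENNReal) ≤ ENNReal.ofReal lam := by
    simpa using ENNReal.ofReal_le_ofReal hlam
  have hlt : ∀ n : ℕ, (n : ℝ) < lam → (n : ENNReal) < ENNReal.ofReal lam := fun n hn => by
    rw [← ENNReal.ofReal_natCast]
    exact (ENNReal.ofReal_lt_ofReal_iff (by linarith)).2 hn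
  have hle : ∀ n : ℕ, (n : ℤ) ≤ ⌊lam⌋ - 1 → (n : ENNReal) + 1 ≤ ENNReal.ofReal lam := by
    intro n hn
    have h := Int.le_floor.1 (le_sub_iff_add_le.1 hn)
    rw [← Nat.cast_one, ← Nat.cast_add, ← ENNReal.ofReal_natCast]
    exact ENNReal.ofReal_le_ofReal (by exact_mod_cast h)
  have h₀ : ((0 : ℕ) : ENNReal) + 1 ≤ ENNReal.ofReal lam := by
    rw [Nat.cast_zero, zero_add]
    exact Fact.out
  refine ⟨fun a b => lpMk 1 μ fun x => F 0 (a x) * G 0 (b x), fun a b =>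
    coeFn_lpMk (hF.memLp_mul hG hL (i := 0) (j := 0) h₀ h₀ a b), fun i j hi hj hij => ?_⟩
  have hij' : ((i + j : ℕ) : ENNReal) < ENNReal.ofReal lam := by
    refine hlt _ (lt_of_not_ge fun h => ?_)
    have := Int.ceil_le.2 (show lam ≤ ((i + j : ℤ) : ℝ) by exact_mod_cast h)
    omega
  have hi' : (i : ENNReal) < ENNReal.ofReal lam :=
    lt_of_le_of_lt (by exact_mod_cast Nat.le_add_right i j) hij'
  have hleft := hF.hasFTaylorSeriesUpTo_left (μ := μ) hG hL (hle i hi) hi'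
  have hright := hF.hasFTaylorSeriesUpTo_right (μ := μ) hG hL (hle i hi) (hle j hj) hij'
  have hD₁ := fun a b => ((hleft b).eq_iteratedFDeriv le_rfl a).symm
  simp only [hD₁]
  have hD₂ := fun a b => ((hright a).eq_iteratedFDeriv le_rfl b).symm
  simp only [hD₂]
  refine ⟨fun b => (hleft b).contDiff, fun a => (hright a).contDiff,
    (lpMulMultilinear₂ _ μ i j).continuous.comp
      (hF.continuous_lpMk_mul hG hL (hle i hi) (hle j hj) hij'), fun a b u v => ?_⟩
  filter_upwards [coeFn_lpMulMultilinear₂ hij'.le (lpMk _ μ fun x => F i (a x) * G j (b x)) u v,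
    coeFn_lpMk (hF.memLp_mul hG hL (hle i hi) (hle j hj) a b)] with x h₁ h₂
  rw [h₁, h₂, hF.iteratedDeriv_eq, hG.iteratedDeriv_eq]
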